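/- Let O ⊂ ℝⁿ (n ≥ 2) be a bounded open set, ϰ > 1, σ ∈ C¹(O) with ϰ⁻¹ ≤ σ ≤ ϰ and |∇σ| ≤ ϰ on O, and u ∈ C²(O) with div(σ∇u) = 0 in O. Let δ > 0, x₀ ∈ O with dist(x₀,∂O) > δ, and suppose H(x₀,ρ) > 0 for every ρ ∈ (0,δ]. Then the frequency function N(x₀,ρ) = ρ D(x₀,ρ)/H(x₀,ρ) satisfies N(x₀,r) ≤ e^{2ϰ²δ} N(x₀,δ) for every 0 < r < δ; more precisely, ρ ↦ e^{2ϰ²ρ} N(x₀,ρ) is nondecreasing on (0,δ]. -/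

import Mathlib

open MeasureTheory Metric Set
open scoped RealInnerProductSpace

noncomputable section

abbrev Euc (n : ℕ) := EuclideanSpace ℝ (Fin n)

/-- Divergence of a vector field on `ℝⁿ`. -/
noncomputable def vdiv {n : ℕ} (F : Euc n → Euc n) (x : Euc n) : ℝ :=
  ∑ i, fderiv ℝ F x (EuclideanSpace.single i 1) i

/-- Surface integral over the sphere `∂B(x₀,r)`:
`∫_{∂B(x₀,r)} f dS = r^{n−1} ∫_{S^{n−1}} f(x₀+rθ) dσ(θ)`, where `σ` is the
surface measure `volume.toSphere` on the unit sphere. -/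
noncomputable def sphIntB (n : ℕ) (x₀ : Euc n) (r : ℝ) (f : Euc n → ℝ) : ℝ :=
  r ^ (n - 1) *
    ∫ θ : Metric.sphere (0 : Euc n) 1, f (x₀ + r • (θ : Euc n))
      ∂((volume : Measure (Euc n)).toSphere)

/-- `H(x₀,r) = ∫_{∂B(x₀,r)} σ u² dS`. -/
noncomputable def Hfn {n : ℕ} (σ u : Euc n → ℝ) (x₀ : Euc n) (r : ℝ) : ℝ :=
  sphIntB n x₀ r (fun y => σ y * u y ^ 2)

/-- `D(x₀,r) = ∫_{B(x₀,r)} σ |∇u|² dx`. -/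
noncomputable def Dfn {n : ℕ} (σ u : Euc n → ℝ) (x₀ : Euc n) (r : ℝ) : ℝ :=
  ∫ x in ball x₀ r, σ x * ‖gradient u x‖ ^ 2

/-- `K(x₀,r) = ∫_{B(x₀,r)} σ u² dx`. -/
noncomputable def Kfn {n : ℕ} (σ u : Euc n → ℝ) (x₀ : Euc n) (r : ℝ) : ℝ :=
  ∫ x in ball x₀ r, σ x * u x ^ 2

/-- `H̃(x₀,r) = ∫_{∂B(x₀,r)} u² ∇σ·ν dS`, with `ν(x₀+rθ) = θ`. -/
noncomputable def Htilde {n : ℕ} (σ u : Euc n → ℝ) (x₀ : Euc n) (r : ℝ) : ℝ :=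
  r ^ (n - 1) *
    ∫ θ : Metric.sphere (0 : Euc n) 1,
      u (x₀ + r • (θ : Euc n)) ^ 2 * ⟪gradient σ (x₀ + r • (θ : Euc n)), (θ : Euc n)⟫
      ∂((volume : Measure (Euc n)).toSphere)

/-- `Ĥ(x₀,r) = ∫_{∂B(x₀,r)} σ (∂_ν u)² dS`, with `∂_ν u(x₀+rθ) = ∇u(x₀+rθ)·θ`. -/
noncomputable def Hhat {n : ℕ} (σ u : Euc n → ℝ) (x₀ : Euc n) (r : ℝ) : ℝ :=
  r ^ (n - 1) *
    ∫ θ : Metric.sphere (0 : Euc n) 1,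
      σ (x₀ + r • (θ : Euc n)) * ⟪gradient u (x₀ + r • (θ : Euc n)), (θ : Euc n)⟫ ^ 2
      ∂((volume : Measure (Euc n)).toSphere)

/-- `D̃(x₀,r) = ∫_{B(x₀,r)} |∇u|² ∇σ·(x−x₀) dx`. -/
noncomputable def Dtilde {n : ℕ} (σ u : Euc n → ℝ) (x₀ : Euc n) (r : ℝ) : ℝ :=
  ∫ x in ball x₀ r, ‖gradient u x‖ ^ 2 * ⟪gradient σ x, x - x₀⟫

lemma continuous_sphere_comp {n : ℕ} {x₀ : Euc n} {R : ℝ} {f : Euc n → ℝ}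
    (hf : ContinuousOn f (closedBall x₀ R)) {r : ℝ} (hr : r ∈ Icc 0 R) :
    Continuous fun θ : sphere (0 : Euc n) 1 => f (x₀ + r • (θ : Euc n)) := by
  refine hf.comp_continuous (by fun_prop) fun θ => ?_
  simp [norm_smul, abs_of_nonneg hr.1, hr.2]

lemma integrable_sphere_comp {n : ℕ} {x₀ : Euc n} {R : ℝ} {f : Euc n → ℝ}
    (hf : ContinuousOn f (closedBall x₀ R)) {r : ℝ} (hr : r ∈ Icc 0 R) :
    Integrable (fun θ : sphere (0 : Euc n) 1 => f (x₀ + r • (θ : Euc n)))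
      (volume : Measure (Euc n)).toSphere :=
  (continuous_sphere_comp hf hr).integrable_of_hasCompactSupport (.of_compactSpace _)

lemma continuousOn_sphIntB {n : ℕ} {x₀ : Euc n} {R : ℝ} {f : Euc n → ℝ}
    (hf : ContinuousOn f (closedBall x₀ R)) :
    ContinuousOn (fun r => sphIntB n x₀ r f) (Icc 0 R) := by
  rcases lt_or_ge R 0 with hR | hR
  · simp [hR]
  have hc : Continuous fun p : ℝ × sphere (0 : Euc n) 1 =>
      f (x₀ + (projIcc 0 R hR p.1 : ℝ) • (p.2 : Euc n)) := by
    refine hf.comp_continuous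
      (by
        have := (continuous_projIcc (a := (0 : ℝ)) (b := R) (h := hR))
        fun_prop) fun p => ?_
    have := (projIcc 0 R hR p.1).2
    simp [norm_smul, abs_of_nonneg this.1, this.2]
  have hI : Continuous fun r : ℝ => ∫ θ : sphere (0 : Euc n) 1,
      f (x₀ + (projIcc 0 R hR r : ℝ) • (θ : Euc n)) ∂(volume : Measure (Euc n)).toSphere := by
    simpa using continuous_parametric_integral_of_continuous
      (μ := (volume : Measure (Euc n)).toSphere) (f := fun r θ =>
        f (x₀ + (projIcc 0 R hR r : ℝ) • (θ : Euc n))) hc isCompact_univ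
  refine ((continuous_pow (n - 1)).mul hI).continuousOn.congr fun r hr => ?_
  simp [sphIntB, projIcc_of_mem hR hr]

lemma sphIntB_congr {n : ℕ} {x₀ : Euc n} {r : ℝ} (hr : 0 ≤ r) {f g : Euc n → ℝ}
    (h : ∀ y, ‖y - x₀‖ = r → f y = g y) : sphIntB n x₀ r f = sphIntB n x₀ r g := by
  unfold sphIntB
  congr 2
  ext θ
  exact h _ (by simp [norm_smul, abs_of_nonneg hr])

lemma sphIntB_const_mul {n : ℕ} (x₀ : Euc n) (r c : ℝ) (f : Euc n → ℝ) :
    sphIntB n x₀ r (fun y => c * f y) = c * sphIntB n x₀ r f := by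
  simp only [sphIntB, integral_const_mul]
  ring

lemma sphIntB_add {n : ℕ} {x₀ : Euc n} {R r : ℝ} (hr : r ∈ Icc 0 R) {f g : Euc n → ℝ}
    (hf : ContinuousOn f (closedBall x₀ R)) (hg : ContinuousOn g (closedBall x₀ R)) :
    sphIntB n x₀ r (fun y => f y + g y) = sphIntB n x₀ r f + sphIntB n x₀ r g := by
  simp only [sphIntB]
  rw [integral_add (integrable_sphere_comp hf hr) (integrable_sphere_comp hg hr)]
  ring

lemma sphIntB_mono {n : ℕ} {x₀ : Euc n} {R r : ℝ} (hr : r ∈ Icc 0 R) {f g : Euc n → ℝ}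
    (hf : ContinuousOn f (closedBall x₀ R)) (hg : ContinuousOn g (closedBall x₀ R))
    (h : ∀ y, ‖y - x₀‖ = r → f y ≤ g y) : sphIntB n x₀ r f ≤ sphIntB n x₀ r g := by
  refine mul_le_mul_of_nonneg_left ?_ (pow_nonneg hr.1 _)
  refine integral_mono (integrable_sphere_comp hf hr) (integrable_sphere_comp hg hr) fun θ => ?_
  exact h _ (by simp [norm_smul, abs_of_nonneg hr.1])

lemma setIntegral_ball_eq_integral_sphIntB {n : ℕ} (hn : n ≠ 0) {x₀ : Euc n} {R : ℝ}
    {f : Euc n → ℝ} (hf : ContinuousOn f (closedBall x₀ R)) {r : ℝ} (hr : r ∈ Icc 0 R) :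
    ∫ x in ball x₀ r, f x = ∫ ρ in (0 : ℝ)..r, sphIntB n x₀ ρ f := by
  have : Nonempty (Fin n) := Fin.pos_iff_nonempty.1 (Nat.pos_of_ne_zero hn)
  have : Nontrivial (Euc n) := inferInstance
  set g : Euc n → ℝ := fun x => (ball x₀ r).indicator f (x₀ + x) with hg
  have hgi : Integrable g := by
    refine Integrable.comp_add_left (f := (ball x₀ r).indicator f) ?_ x₀
    rw [integrable_indicator_iff measurableSet_ball]
    exact (hf.integrableOn_compact (isCompact_closedBall _ _)).mono_set
      (ball_subset_closedBall.trans (closedBall_subset_closedBall hr.2))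
  have hmp := (volume : Measure (Euc n)).measurePreserving_homeomorphUnitSphereProd.symm
    (homeomorphUnitSphereProd (Euc n)).toMeasurableEquiv
  have hemb := (homeomorphUnitSphereProd (Euc n)).symm.measurableEmbedding
  have hd : Module.finrank ℝ (Euc n) - 1 = n - 1 := by simp
  have h0 : MeasurableSet ({0}ᶜ : Set (Euc n)) := (measurableSet_singleton _).compl
  have hgi' : Integrable (fun x : ({0}ᶜ : Set (Euc n)) => g x)
      ((volume : Measure (Euc n)).comap (↑)) := by
    have := (integrableOn_iff_comap_subtypeVal (μ := volume) (f := g) h0).1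
    rw [IntegrableOn, restrict_compl_singleton] at this
    exact this hgi
  have hgi2 : Integrable (fun p : sphere (0 : Euc n) 1 × Ioi (0 : ℝ) => g ((p.2 : ℝ) • (p.1 : Euc n)))
      ((volume : Measure (Euc n)).toSphere.prod (Measure.volumeIoiPow (n - 1))) := by
    rw [← hd]
    exact (hmp.integrable_comp_emb hemb (g := fun x : ({0}ᶜ : Set (Euc n)) => g x)).2 hgi'
  have e1 : ∫ x in ball x₀ r, f x = ∫ x, g x := by
    rw [← integral_indicator measurableSet_ball, hg]
    exact (integral_add_left_eq_self _ x₀).symm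
  have e2 : ∫ x, g x = ∫ x : ({0}ᶜ : Set (Euc n)), g x ∂((volume : Measure (Euc n)).comap (↑)) := by
    rw [integral_subtype_comap h0 g, restrict_compl_singleton]
  have e3 : ∫ x : ({0}ᶜ : Set (Euc n)), g x ∂((volume : Measure (Euc n)).comap (↑)) =
      ∫ p : sphere (0 : Euc n) 1 × Ioi (0 : ℝ), g ((p.2 : ℝ) • (p.1 : Euc n))
        ∂((volume : Measure (Euc n)).toSphere.prod (Measure.volumeIoiPow (n - 1))) := by
    rw [← hd]
    exact (hmp.integral_comp hemb fun x : ({0}ᶜ : Set (Euc n)) => g x).symm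
  rw [e1, e2, e3, integral_prod_symm _ hgi2, Measure.volumeIoiPow]
  simp_rw [ENNReal.ofReal]
  rw [integral_withDensity_eq_integral_smul (by fun_prop),
    integral_subtype_comap measurableSet_Ioi (fun ρ : ℝ => Real.toNNReal (ρ ^ (n - 1)) •
      ∫ θ : sphere (0 : Euc n) 1, g (ρ • (θ : Euc n)) ∂(volume : Measure (Euc n)).toSphere),
    intervalIntegral.integral_of_le hr.1, integral_Ioc_eq_integral_Ioo, ← Ioi_inter_Iio,
    ← setIntegral_indicator measurableSet_Iio]
  refine setIntegral_congr_fun measurableSet_Ioi fun ρ hρ => ?_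
  have hρ0 : 0 < ρ := hρ
  have hnorm : ∀ θ : sphere (0 : Euc n) 1, ‖ρ • (θ : Euc n)‖ = ρ := fun θ => by
    simp [norm_smul, abs_of_pos hρ0]
  by_cases hlt : ρ < r
  · simp [g, indicator, hnorm, hlt, sphIntB, NNReal.smul_def, hρ0.le]
  · simp [g, indicator, hnorm, hlt]

lemma vdiv_smul {n : ℕ} {φ : Euc n → ℝ} {F : Euc n → Euc n} {x : Euc n}
    (hφ : DifferentiableAt ℝ φ x) (hF : DifferentiableAt ℝ F x) :
    vdiv (fun y => φ y • F y) x = φ x * vdiv F x + fderiv ℝ φ x (F x) := by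
  have hsum : fderiv ℝ φ x (F x) =
      ∑ i, F x i * fderiv ℝ φ x (EuclideanSpace.single i 1) := by
    conv_lhs => rw [← (EuclideanSpace.basisFun (Fin n) ℝ).sum_repr (F x)]
    simp
  rw [hsum]
  simp only [vdiv, fderiv_fun_smul hφ hF, Finset.mul_sum, ← Finset.sum_add_distrib]
  refine Finset.sum_congr rfl fun i _ => ?_
  simp [mul_comm]

lemma vdiv_sub {n : ℕ} {F G : Euc n → Euc n} {x : Euc n}
    (hF : DifferentiableAt ℝ F x) (hG : DifferentiableAt ℝ G x) :
    vdiv (fun y => F y - G y) x = vdiv F x - vdiv G x := by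
  simp [vdiv, fderiv_fun_sub hF hG, Finset.sum_sub_distrib]

lemma vdiv_sub_const_id {n : ℕ} (x₀ x : Euc n) : vdiv (fun y => y - x₀) x = n := by
  simp [vdiv, fderiv_sub_const]

lemma continuousOn_vdiv {n : ℕ} {U : Set (Euc n)} (hU : IsOpen U) {F : Euc n → Euc n}
    (hF : ContDiffOn ℝ 1 F U) : ContinuousOn (vdiv F) U := by
  have := hF.continuousOn_fderiv_of_isOpen hU le_rfl
  unfold vdiv
  fun_prop

lemma integral_vdiv_eq_zero {n : ℕ} {F : Euc n → Euc n} (hF : ContDiff ℝ 1 F)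
    (hc : HasCompactSupport F) : ∫ x, vdiv F x = 0 := by
  have hd : Continuous (fderiv ℝ F) := hF.continuous_fderiv one_ne_zero
  have hint : ∀ v, Integrable fun x => fderiv ℝ F x v := fun v =>
    (by fun_prop : Continuous fun x => fderiv ℝ F x v).integrable_of_hasCompactSupport
      (hc.fderiv_apply ℝ v)
  have hzero : ∀ v, ∫ x, fderiv ℝ F x v = 0 := fun v => by
    have := integral_smul_fderiv_eq_neg_fderiv_smul_of_integrable (𝕜 := ℝ)
      (μ := (volume : Measure (Euc n))) (f := fun _ => 1) (g := F) (v := v)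
      (by simp) (by simpa using hint v)
      (by simpa using hF.continuous.integrable_of_hasCompactSupport hc)
      (fun _ _ => differentiableAt_const _)
      fun _ _ => (hF.differentiable one_ne_zero).differentiableAt
    simpa using this
  have hproj : ∀ i, Integrable fun x => fderiv ℝ F x (EuclideanSpace.single i 1) i := fun i =>
    (EuclideanSpace.proj (𝕜 := ℝ) i).integrable_comp (hint _)
  simp only [vdiv]
  rw [integral_finsetSum _ fun i _ => hproj i]
  refine Finset.sum_eq_zero fun i _ => ?_
  have := (EuclideanSpace.proj (𝕜 := ℝ) i).integral_comp_comm (hint (EuclideanSpace.single i 1))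
  rw [hzero] at this
  simpa using this

lemma exists_eq_zero_of_tsupport_subset_Ioo {R : ℝ} (hR : 0 < R) {h : ℝ → ℝ}
    (hc : HasCompactSupport h) (hs : tsupport h ⊆ Ioo 0 R) :
    ∃ c ∈ Ioo 0 R, ∀ t, c ≤ t → h t = 0 := by
  rcases (tsupport h).eq_empty_or_nonempty with he | hne
  · refine ⟨R / 2, ⟨by linarith, by linarith⟩, fun t _ => image_eq_zero_of_notMem_tsupport ?_⟩
    simp [he]
  · obtain ⟨m, hm, hmax⟩ := hc.exists_isGreatest hne
    have := hs hm
    refine ⟨(m + R) / 2, ⟨by linarith [this.1], by linarith [this.2]⟩, fun t ht =>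
      image_eq_zero_of_notMem_tsupport fun hmem => ?_⟩
    linarith [hmax hmem, this.2]

lemma setIntegral_vdiv_cutoff {n : ℕ} {U : Set (Euc n)} (hU : IsOpen U)
    {x₀ : Euc n} {R : ℝ} (hRU : closedBall x₀ R ⊆ U) {F : Euc n → Euc n}
    (hF : ContDiffOn ℝ 1 F U) {η η' : ℝ → ℝ} (hη : ∀ s, HasDerivAt η (η' s) s)
    (hη' : Continuous η') {c : ℝ} (hc : c ∈ Ioo 0 R) (hηc : ∀ s, c ^ 2 ≤ s → η s = 0) :
    ∫ x in ball x₀ R, (η (‖x - x₀‖ ^ 2) * vdiv F x +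
      2 * (η' (‖x - x₀‖ ^ 2) * ⟪F x, x - x₀⟫)) = 0 := by
  set φ : Euc n → ℝ := fun x => η (‖x - x₀‖ ^ 2) with hφ
  have hη1 : ContDiff ℝ 1 η := by
    rw [contDiff_one_iff_deriv]
    refine ⟨fun s => (hη s).differentiableAt, ?_⟩
    rwa [show deriv η = η' from funext fun s => (hη s).deriv]
  have hφ1 : ContDiff ℝ 1 φ := hη1.comp ((contDiff_id.sub contDiff_const).norm_sq ℝ)
  have hφd : ∀ x v, fderiv ℝ φ x v = 2 * (η' (‖x - x₀‖ ^ 2) * ⟪v, x - x₀⟫) := fun x v => by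
    have h1 : HasFDerivAt (fun y : Euc n => ‖y - x₀‖ ^ 2) _ x :=
      ((hasFDerivAt_id x).sub_const x₀).norm_sq
    have h2 := (hη (‖x - x₀‖ ^ 2)).comp_hasFDerivAt x h1
    have h3 : fderiv ℝ φ x = _ := h2.fderiv
    rw [h3]
    simp [inner_sub_right, real_inner_comm]
    ring
  have hφ0 : ∀ x, x ∉ ball x₀ c → φ x = 0 := fun x hx => by
    refine hηc _ (pow_le_pow_left₀ hc.1.le ?_ 2)
    simpa [dist_eq_norm] using hx
  have hsupp : tsupport (fun x => φ x • F x) ⊆ closedBall x₀ c := by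
    refine closure_minimal (fun x hx => ?_) isClosed_closedBall
    by_contra hcon
    exact hx (by simp [hφ0 x fun h => hcon (ball_subset_closedBall h)])
  have hcU : closedBall x₀ c ⊆ U := (closedBall_subset_closedBall hc.2.le).trans hRU
  have hC : HasCompactSupport fun x => φ x • F x :=
    (isCompact_closedBall x₀ c).of_isClosed_subset (isClosed_tsupport _) hsupp
  have hD : ContDiff ℝ 1 fun x => φ x • F x := by
    rw [contDiff_iff_contDiffAt]
    intro x
    by_cases hx : x ∈ U
    · exact hφ1.contDiffAt.smul (hF.contDiffAt (hU.mem_nhds hx))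
    · have : x ∉ tsupport fun x => φ x • F x := fun h => hx (hcU (hsupp h))
      exact contDiffAt_const.congr_of_eventuallyEq (notMem_tsupport_iff_eventuallyEq.1 this)
  refine Eq.trans ?_ ((setIntegral_eq_integral_of_forall_compl_eq_zero (s := ball x₀ R) ?_).trans
    (integral_vdiv_eq_zero hD hC))
  · refine setIntegral_congr_fun measurableSet_ball fun x hx => ?_
    have hxU := hRU (ball_subset_closedBall hx)
    rw [vdiv_smul (hφ1.differentiable one_ne_zero).differentiableAt
      ((hF.contDiffAt (hU.mem_nhds hxU)).differentiableAt one_ne_zero), hφd]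
  · intro x hx
    have hx' : x ∉ tsupport (fderiv ℝ fun x => φ x • F x) := fun h =>
      hx (closedBall_subset_ball hc.2 (hsupp (tsupport_fderiv_subset ℝ h)))
    simp [vdiv, image_eq_zero_of_notMem_tsupport hx']

lemma hasDerivAt_integral_sphIntB {n : ℕ} {x₀ : Euc n} {R : ℝ} {f : Euc n → ℝ}
    (hf : ContinuousOn f (closedBall x₀ R)) {r : ℝ} (hr : r ∈ Ioo 0 R) :
    HasDerivAt (fun ρ => ∫ t in (0 : ℝ)..ρ, sphIntB n x₀ t f) (sphIntB n x₀ r f) r := by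
  have hc := continuousOn_sphIntB hf
  refine intervalIntegral.integral_hasDerivAt_right
    ((hc.mono ?_).intervalIntegrable) ?_ (hc.continuousAt (Icc_mem_nhds hr.1 hr.2))
  · rw [uIcc_of_le hr.1.le]
    exact Icc_subset_Icc_right hr.2.le
  · exact (hc.mono Ioo_subset_Icc_self).stronglyMeasurableAtFilter isOpen_Ioo r hr

lemma hasDerivAt_setIntegral_ball {n : ℕ} (hn : n ≠ 0) {x₀ : Euc n} {R : ℝ} {f : Euc n → ℝ}
    (hf : ContinuousOn f (closedBall x₀ R)) {r : ℝ} (hr : r ∈ Ioo 0 R) :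
    HasDerivAt (fun ρ => ∫ x in ball x₀ ρ, f x) (sphIntB n x₀ r f) r := by
  refine (hasDerivAt_integral_sphIntB hf hr).congr_of_eventuallyEq ?_
  filter_upwards [Icc_mem_nhds hr.1 hr.2] with ρ hρ
  exact setIntegral_ball_eq_integral_sphIntB hn hf hρ

/-- The divergence theorem on a ball, with the unit normal replaced by `y - x₀`. -/
theorem mul_setIntegral_ball_vdiv {n : ℕ} (hn : n ≠ 0) {U : Set (Euc n)} (hU : IsOpen U)
    {x₀ : Euc n} {R : ℝ} (hRU : closedBall x₀ R ⊆ U) {F : Euc n → Euc n}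
    (hF : ContDiffOn ℝ 1 F U) {r : ℝ} (hr : r ∈ Ioo 0 R) :
    r * ∫ x in ball x₀ r, vdiv F x = sphIntB n x₀ r fun y => ⟪F y, y - x₀⟫ := by
  have hR : 0 < R := hr.1.trans hr.2
  have ha : ContinuousOn (vdiv F) (closedBall x₀ R) := (continuousOn_vdiv hU hF).mono hRU
  have hb : ContinuousOn (fun y => ⟪F y, y - x₀⟫) (closedBall x₀ R) :=
    (hF.continuousOn.mono hRU).inner (by fun_prop)
  set a : ℝ → ℝ := fun ρ => sphIntB n x₀ ρ (vdiv F)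
  set B : ℝ → ℝ := fun ρ => sphIntB n x₀ ρ fun y => ⟪F y, y - x₀⟫
  set A : ℝ → ℝ := fun ρ => ∫ t in (0 : ℝ)..ρ, a t
  have hac : ContinuousOn a (Icc 0 R) := continuousOn_sphIntB ha
  have hBc : ContinuousOn B (Icc 0 R) := continuousOn_sphIntB hb
  have hAc : ContinuousOn A (Icc 0 R) := by
    have := intervalIntegral.continuousOn_primitive_interval (μ := volume) (f := a) (a := 0) (b := R)
      (by rw [uIcc_of_le hR.le]; exact hac.integrableOn_Icc)
    rwa [uIcc_of_le hR.le] at this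
  have huIcc : uIcc 0 R = Icc 0 R := uIcc_of_le hR.le
  have key : ∀ h : ℝ → ℝ, Continuous h → HasCompactSupport h → tsupport h ⊆ Ioo 0 R →
      ∫ ρ in (0 : ℝ)..R, h ρ * (B ρ - ρ * A ρ) = 0 := by
    intro h hh hhc hhs
    obtain ⟨c, hc, hc0⟩ := exists_eq_zero_of_tsupport_subset_Ioo hR hhc hhs
    set g : ℝ → ℝ := fun s => h (√s)
    have hg : Continuous g := hh.comp Real.continuous_sqrt
    set η : ℝ → ℝ := fun s => ∫ t in (c ^ 2)..s, g t
    have hη : ∀ s, HasDerivAt η (g s) s := fun s =>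
      (hg.integral_hasStrictDerivAt _ s).hasDerivAt
    have hηc : ∀ s, c ^ 2 ≤ s → η s = 0 := fun s hs => by
      refine (intervalIntegral.integral_congr fun t ht => ?_).trans
        intervalIntegral.integral_zero
      rw [uIcc_of_le hs] at ht
      exact hc0 _ (Real.le_sqrt_of_sq_le ht.1)
    have hηcont : Continuous η := continuous_iff_continuousAt.2 fun s => (hη s).continuousAt
    have h1 := setIntegral_vdiv_cutoff hU hRU hF hη hg hc hηc
    have hcont1 : ContinuousOn (fun x => η (‖x - x₀‖ ^ 2) * vdiv F x) (closedBall x₀ R) :=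
      ContinuousOn.mul (by fun_prop) ha
    have hcont2 : ContinuousOn (fun x => 2 * (g (‖x - x₀‖ ^ 2) * ⟪F x, x - x₀⟫))
        (closedBall x₀ R) :=
      continuousOn_const.mul (ContinuousOn.mul (by fun_prop) hb)
    rw [setIntegral_ball_eq_integral_sphIntB hn (hcont1.fun_add hcont2) ⟨hR.le, le_rfl⟩] at h1
    have h2 : ∫ ρ in (0 : ℝ)..R, (η (ρ ^ 2) * a ρ + 2 * (h ρ * B ρ)) = 0 := by
      refine (intervalIntegral.integral_congr fun ρ hρ => ?_).trans h1
      rw [huIcc] at hρ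
      rw [sphIntB_add hρ hcont1 hcont2, sphIntB_const_mul]
      have e1 : sphIntB n x₀ ρ (fun x => η (‖x - x₀‖ ^ 2) * vdiv F x) = η (ρ ^ 2) * a ρ := by
        rw [← sphIntB_const_mul]
        exact sphIntB_congr hρ.1 fun y hy => by rw [hy]
      have e2 : sphIntB n x₀ ρ (fun x => g (‖x - x₀‖ ^ 2) * ⟪F x, x - x₀⟫) = h ρ * B ρ := by
        rw [← sphIntB_const_mul]
        exact sphIntB_congr hρ.1 fun y hy => by simp [g, hy, Real.sqrt_sq hρ.1]
      rw [e1, e2]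
    have h3 : ∫ ρ in (0 : ℝ)..R, ((2 * ρ * h ρ) * A ρ + η (ρ ^ 2) * a ρ) = 0 := by
      rw [intervalIntegral.integral_deriv_mul_eq_sub_of_hasDerivAt
        (u := fun ρ => η (ρ ^ 2)) (v := A)]
      · simp [hηc (R ^ 2) (pow_le_pow_left₀ hc.1.le hc.2.le 2), A]
      · fun_prop
      · rwa [huIcc]
      · intro ρ hρ
        rw [min_eq_left hR.le, max_eq_right hR.le] at hρ
        have := (hη (ρ ^ 2)).comp ρ (hasDerivAt_pow 2 ρ)
        refine this.congr_deriv ?_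
        simp [g, Real.sqrt_sq hρ.1.le]
        ring
      · intro ρ hρ
        rw [min_eq_left hR.le, max_eq_right hR.le] at hρ
        exact hasDerivAt_integral_sphIntB ha hρ
      · exact Continuous.intervalIntegrable (by fun_prop) _ _
      · exact ContinuousOn.intervalIntegrable (by rwa [huIcc])
    have h4 : ∫ ρ in (0 : ℝ)..R, 2 * (h ρ * (B ρ - ρ * A ρ)) = 0 := by
      have i2 : IntervalIntegrable (fun ρ => η (ρ ^ 2) * a ρ + 2 * (h ρ * B ρ)) volume 0 R := by
        refine ContinuousOn.intervalIntegrable ?_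
        rw [huIcc]
        fun_prop
      have i3 : IntervalIntegrable (fun ρ => 2 * ρ * h ρ * A ρ + η (ρ ^ 2) * a ρ) volume 0 R := by
        refine ContinuousOn.intervalIntegrable ?_
        rw [huIcc]
        fun_prop
      have hsub := intervalIntegral.integral_sub i2 i3
      rw [h2, h3, sub_zero] at hsub
      refine (intervalIntegral.integral_congr fun ρ _ => ?_).trans hsub
      ring
    rw [intervalIntegral.integral_const_mul] at h4
    simpa using h4
  have hfc : ContinuousOn (fun ρ => B ρ - ρ * A ρ) (Ioo 0 R) := by
    refine ContinuousOn.mono ?_ Ioo_subset_Icc_self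
    fun_prop
  have hae := isOpen_Ioo.ae_eq_zero_of_integral_contDiff_smul_eq_zero (μ := volume)
    (hfc.locallyIntegrableOn measurableSet_Ioo) fun h hh hhc hhs => by
      rw [← key h hh.continuous hhc hhs, intervalIntegral.integral_of_le hR.le,
        setIntegral_eq_integral_of_forall_compl_eq_zero]
      · rfl
      · intro ρ hρ
        rw [image_eq_zero_of_notMem_tsupport fun h => hρ (Ioo_subset_Ioc_self (hhs h)), zero_mul]
  have heq := Measure.eqOn_open_of_ae_eq (μ := (volume : Measure ℝ)) (f := fun ρ => B ρ - ρ * A ρ)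
    (g := fun _ => (0 : ℝ))
    ((ae_restrict_iff' measurableSet_Ioo).2 hae) isOpen_Ioo hfc continuousOn_const hr
  rw [setIntegral_ball_eq_integral_sphIntB hn ha ⟨hr.1.le, hr.2.le⟩]
  simp only [] at heq
  linarith

lemma contDiffOn_gradient {n : ℕ} {U : Set (Euc n)} (hU : IsOpen U) {u : Euc n → ℝ}
    {k m : WithTop ℕ∞} (hu : ContDiffOn ℝ m u U) (hk : k + 1 ≤ m) :
    ContDiffOn ℝ k (gradient u) U :=
  (InnerProductSpace.toDual ℝ (Euc n)).symm.contDiff.comp_contDiffOn (hu.fderiv_of_isOpen hU hk)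

lemma inner_fderiv_gradient_comm {n : ℕ} {u : Euc n → ℝ} {x : Euc n} (hu : ContDiffAt ℝ 2 u x)
    (v w : Euc n) :
    ⟪fderiv ℝ (gradient u) x v, w⟫ = ⟪fderiv ℝ (gradient u) x w, v⟫ := by
  have hd : DifferentiableAt ℝ (fderiv ℝ u) x :=
    (hu.fderiv_right (m := 1) (by norm_num)).differentiableAt one_ne_zero
  have hg : HasFDerivAt (gradient u)
      ((InnerProductSpace.toDual ℝ (Euc n)).symm.toContinuousLinearEquiv.toContinuousLinearMap.comp
        (fderiv ℝ (fderiv ℝ u) x)) x :=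
    (InnerProductSpace.toDual ℝ (Euc n)).symm.toContinuousLinearEquiv.hasFDerivAt.comp x
      hd.hasFDerivAt
  have hsym := hu.isSymmSndFDerivAt (by simp)
  rw [hg.fderiv]
  simpa using hsym v w

lemma mul_Dfn_eq_sphIntB {n : ℕ} (hn : n ≠ 0) {O : Set (Euc n)} (hO : IsOpen O) {σ u : Euc n → ℝ}
    (hσ : ContDiffOn ℝ 1 σ O) (hu : ContDiffOn ℝ 2 u O)
    (hpde : ∀ x ∈ O, vdiv (fun y => σ y • gradient u y) x = 0) {x₀ : Euc n} {R : ℝ}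
    (hRO : closedBall x₀ R ⊆ O) {r : ℝ} (hr : r ∈ Ioo 0 R) :
    r * Dfn σ u x₀ r = sphIntB n x₀ r fun y => σ y * (u y * ⟪gradient u y, y - x₀⟫) := by
  have hG := contDiffOn_gradient hO hu (k := 1) (by norm_num)
  have hu1 : ContDiffOn ℝ 1 u O := hu.of_le (by norm_num)
  have hF : ContDiffOn ℝ 1 (fun y => u y • (σ y • gradient u y)) O := hu1.smul (hσ.smul hG)
  have hdiv := mul_setIntegral_ball_vdiv hn hO hRO hF hr
  have e1 : Dfn σ u x₀ r =
      ∫ x in ball x₀ r, vdiv (fun y => u y • (σ y • gradient u y)) x := by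
    refine setIntegral_congr_fun measurableSet_ball fun x hx => ?_
    have hxO : O ∈ nhds x := hO.mem_nhds
      (hRO (closedBall_subset_closedBall hr.2.le (ball_subset_closedBall hx)))
    have dσ := (hσ.contDiffAt hxO).differentiableAt one_ne_zero
    have dG := (hG.contDiffAt hxO).differentiableAt one_ne_zero
    have du := (hu1.contDiffAt hxO).differentiableAt one_ne_zero
    rw [vdiv_smul du (dσ.fun_smul dG), hpde x (mem_of_mem_nhds hxO), ← inner_gradient_left,
      real_inner_smul_right, real_inner_self_eq_norm_sq]
    ring
  rw [e1]
  refine hdiv.trans (sphIntB_congr hr.1.le fun y _ => ?_)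
  simp only [real_inner_smul_left]
  ring

lemma hasDerivAt_Hfn {n : ℕ} (hn : n ≠ 0) {O : Set (Euc n)} (hO : IsOpen O) {σ u : Euc n → ℝ}
    (hσ : ContDiffOn ℝ 1 σ O) (hu : ContDiffOn ℝ 1 u O) {x₀ : Euc n} {R : ℝ}
    (hRO : closedBall x₀ R ⊆ O) {r : ℝ} (hr : r ∈ Ioo 0 R) :
    HasDerivAt (Hfn σ u x₀) (((n - 1) * Hfn σ u x₀ r +
      sphIntB n x₀ r (fun y => u y ^ 2 * ⟪gradient σ y, y - x₀⟫) +
      2 * sphIntB n x₀ r fun y => σ y * (u y * ⟪gradient u y, y - x₀⟫)) / r) r := by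
  have cσ := hσ.continuousOn.mono hRO
  have cu := hu.continuousOn.mono hRO
  have cGu := (contDiffOn_gradient hO hu (k := 0) (by norm_num)).continuousOn.mono hRO
  have cGσ := (contDiffOn_gradient hO hσ (k := 0) (by norm_num)).continuousOn.mono hRO
  have hF : ContDiffOn ℝ 1 (fun y => (σ y * u y ^ 2) • (y - x₀)) O :=
    (hσ.mul (hu.pow 2)).smul (contDiffOn_id.sub contDiffOn_const)
  have hvd : ∀ x ∈ closedBall x₀ R, vdiv (fun y => (σ y * u y ^ 2) • (y - x₀)) x =
      (n * (σ x * u x ^ 2) + u x ^ 2 * ⟪gradient σ x, x - x₀⟫) +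
        2 * (σ x * (u x * ⟪gradient u x, x - x₀⟫)) := fun x hx => by
    have hxO : O ∈ nhds x := hO.mem_nhds (hRO hx)
    have dσ := (hσ.contDiffAt hxO).differentiableAt one_ne_zero
    have du := (hu.contDiffAt hxO).differentiableAt one_ne_zero
    rw [vdiv_smul (dσ.fun_mul (du.fun_pow 2)) (by fun_prop), vdiv_sub_const_id,
      fderiv_fun_mul dσ (du.fun_pow 2), fderiv_fun_pow 2 du, inner_gradient_left,
      inner_gradient_left]
    simp
    ring
  set G : ℝ → ℝ := fun ρ => ∫ x in ball x₀ ρ, vdiv (fun y => (σ y * u y ^ 2) • (y - x₀)) x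
  have hH : ∀ ρ ∈ Ioo 0 R, ρ * Hfn σ u x₀ ρ = G ρ := fun ρ hρ => by
    have h1 := mul_setIntegral_ball_vdiv hn hO hRO hF hρ
    have h2 : (sphIntB n x₀ ρ fun y => ⟪(σ y * u y ^ 2) • (y - x₀), y - x₀⟫) =
        ρ ^ 2 * Hfn σ u x₀ ρ := by
      rw [Hfn, ← sphIntB_const_mul]
      refine sphIntB_congr hρ.1.le fun y hy => ?_
      rw [real_inner_smul_left, real_inner_self_eq_norm_sq, hy]
      ring
    refine mul_left_cancel₀ hρ.1.ne' ?_
    rw [h1, h2]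
    ring
  have hGd : HasDerivAt G _ r :=
    hasDerivAt_setIntegral_ball hn ((continuousOn_vdiv hO hF).mono hRO) hr
  have hrI : r ∈ Icc 0 R := Ioo_subset_Icc_self hr
  have hS : sphIntB n x₀ r (vdiv fun y => (σ y * u y ^ 2) • (y - x₀)) =
      n * Hfn σ u x₀ r + sphIntB n x₀ r (fun y => u y ^ 2 * ⟪gradient σ y, y - x₀⟫) +
      2 * sphIntB n x₀ r fun y => σ y * (u y * ⟪gradient u y, y - x₀⟫) := by
    rw [sphIntB_congr hr.1.le fun y hy => hvd y (by simpa [dist_eq_norm, hy] using hr.2.le),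
      sphIntB_add hrI (by fun_prop) (by fun_prop), sphIntB_add hrI (by fun_prop) (by fun_prop),
      sphIntB_const_mul, sphIntB_const_mul, Hfn]
  have hq := hGd.div (hasDerivAt_id r) hr.1.ne'
  refine (hq.congr_of_eventuallyEq ?_).congr_deriv ?_
  · filter_upwards [isOpen_Ioo.mem_nhds hr] with ρ hρ
    simp only [Pi.div_apply, id]
    rw [← hH ρ hρ, mul_div_cancel_left₀ _ hρ.1.ne']
  · have hr0 := hr.1.ne'
    rw [hS, ← hH r hr]
    simp only [id]
    field_simp
    ring

/-- The Rellich–Pohozaev identity for `div (σ ∇u) = 0` on a ball. -/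
lemma rellich_identity {n : ℕ} (hn : n ≠ 0) {O : Set (Euc n)} (hO : IsOpen O) {σ u : Euc n → ℝ}
    (hσ : ContDiffOn ℝ 1 σ O) (hu : ContDiffOn ℝ 2 u O)
    (hpde : ∀ x ∈ O, vdiv (fun y => σ y • gradient u y) x = 0) {x₀ : Euc n} {R : ℝ}
    (hRO : closedBall x₀ R ⊆ O) {r : ℝ} (hr : r ∈ Ioo 0 R) :
    r * ((n - 2) * Dfn σ u x₀ r + Dtilde σ u x₀ r) =
      r ^ 2 * sphIntB n x₀ r (fun y => σ y * ‖gradient u y‖ ^ 2) -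
        2 * sphIntB n x₀ r fun y => σ y * ⟪gradient u y, y - x₀⟫ ^ 2 := by
  have hG := contDiffOn_gradient hO hu (k := 1) (by norm_num)
  have cσ := hσ.continuousOn.mono hRO
  have cG := hG.continuousOn.mono hRO
  have cGσ := (contDiffOn_gradient hO hσ (k := 0) (by norm_num)).continuousOn.mono hRO
  have hid : ContDiffOn ℝ 1 (fun y : Euc n => y - x₀) O := contDiffOn_id.sub contDiffOn_const
  have hs : ContDiffOn ℝ 1 (fun y => σ y * ‖gradient u y‖ ^ 2) O := hσ.mul (hG.norm_sq ℝ)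
  have hp : ContDiffOn ℝ 1 (fun y => 2 * ⟪gradient u y, y - x₀⟫) O :=
    contDiffOn_const.mul (hG.inner ℝ hid)
  have hF : ContDiffOn ℝ 1 (fun y => (σ y * ‖gradient u y‖ ^ 2) • (y - x₀) -
      (2 * ⟪gradient u y, y - x₀⟫) • (σ y • gradient u y)) O :=
    (hs.smul hid).sub (hp.smul (hσ.smul hG))
  have hdiv := mul_setIntegral_ball_vdiv hn hO hRO hF hr
  have hrI : r ∈ Icc 0 R := Ioo_subset_Icc_self hr
  have hsub : ball x₀ r ⊆ closedBall x₀ R :=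
    ball_subset_closedBall.trans (closedBall_subset_closedBall hr.2.le)
  have hvd : ∀ x ∈ O, vdiv (fun y => (σ y * ‖gradient u y‖ ^ 2) • (y - x₀) -
        (2 * ⟪gradient u y, y - x₀⟫) • (σ y • gradient u y)) x =
      (n - 2) * (σ x * ‖gradient u x‖ ^ 2) + ‖gradient u x‖ ^ 2 * ⟪gradient σ x, x - x₀⟫ := by
    intro x hx
    have hxO := hO.mem_nhds hx
    have dσ := (hσ.contDiffAt hxO).differentiableAt one_ne_zero
    have dG := (hG.contDiffAt hxO).differentiableAt one_ne_zero
    have ds := (hs.contDiffAt hxO).differentiableAt one_ne_zero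
    have dp := (hp.contDiffAt hxO).differentiableAt one_ne_zero
    have did : DifferentiableAt ℝ (fun y : Euc n => y - x₀) x := by fun_prop
    have hsd : fderiv ℝ (fun y => σ y * ‖gradient u y‖ ^ 2) x (x - x₀) =
        ‖gradient u x‖ ^ 2 * ⟪gradient σ x, x - x₀⟫ +
          2 * σ x * ⟪gradient u x, fderiv ℝ (gradient u) x (x - x₀)⟫ := by
      rw [(dσ.hasFDerivAt.fun_mul dG.hasFDerivAt.norm_sq).fderiv, inner_gradient_left]
      simp
      ring
    have hpd : ∀ v, fderiv ℝ (fun y => 2 * ⟪gradient u y, y - x₀⟫) x v =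
        2 * (⟪gradient u x, v⟫ + ⟪fderiv ℝ (gradient u) x v, x - x₀⟫) := fun v => by
      have h : HasFDerivAt (fun y => 2 * ⟪gradient u y, y - x₀⟫) _ x :=
        (dG.hasFDerivAt.inner ℝ ((hasFDerivAt_id x).sub_const x₀)).const_mul 2
      rw [h.fderiv]
      simp
    rw [vdiv_sub (ds.fun_smul did) (dp.fun_smul (dσ.fun_smul dG)), vdiv_smul ds did,
      vdiv_smul dp (dσ.fun_smul dG), hpde x hx, vdiv_sub_const_id, hsd, hpd,
      inner_fderiv_gradient_comm (hu.contDiffAt hxO), real_inner_smul_right,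
      real_inner_smul_right, real_inner_self_eq_norm_sq,
      real_inner_comm (gradient u x) (fderiv ℝ (gradient u) x (x - x₀))]
    ring
  have hint : ∀ {f : Euc n → ℝ}, ContinuousOn f (closedBall x₀ R) →
      IntegrableOn f (ball x₀ r) := fun hf =>
    (hf.integrableOn_compact (isCompact_closedBall _ _)).mono_set hsub
  have e1 : (n - 2) * Dfn σ u x₀ r + Dtilde σ u x₀ r =
      ∫ x in ball x₀ r, vdiv (fun y => (σ y * ‖gradient u y‖ ^ 2) • (y - x₀) -
        (2 * ⟪gradient u y, y - x₀⟫) • (σ y • gradient u y)) x := by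
    rw [setIntegral_congr_fun measurableSet_ball fun x hx => hvd x (hRO (hsub hx)),
      integral_add (hint (by fun_prop)) (hint (by fun_prop)), integral_const_mul, Dfn, Dtilde]
  rw [e1]
  refine hdiv.trans ?_
  have e2 : (sphIntB n x₀ r fun y => ⟪(σ y * ‖gradient u y‖ ^ 2) • (y - x₀) -
        (2 * ⟪gradient u y, y - x₀⟫) • (σ y • gradient u y), y - x₀⟫) =
      sphIntB n x₀ r fun y => r ^ 2 * (σ y * ‖gradient u y‖ ^ 2) +
        (-2) * (σ y * ⟪gradient u y, y - x₀⟫ ^ 2) := by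
    refine sphIntB_congr hr.1.le fun y hy => ?_
    rw [inner_sub_left, real_inner_smul_left, real_inner_smul_left, real_inner_smul_left,
      real_inner_self_eq_norm_sq, hy]
    ring
  refine e2.trans ?_
  rw [sphIntB_add hrI (by fun_prop) (by fun_prop), sphIntB_const_mul, sphIntB_const_mul]
  ring

lemma sphIntB_cauchy_schwarz {n : ℕ} {x₀ : Euc n} {R r : ℝ} (hr : r ∈ Icc 0 R)
    {w f g : Euc n → ℝ} (cw : ContinuousOn w (closedBall x₀ R))
    (cf : ContinuousOn f (closedBall x₀ R)) (cg : ContinuousOn g (closedBall x₀ R))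
    (hw : ∀ y ∈ closedBall x₀ R, 0 ≤ w y) :
    sphIntB n x₀ r (fun y => w y * (f y * g y)) ^ 2 ≤
      sphIntB n x₀ r (fun y => w y * f y ^ 2) * sphIntB n x₀ r (fun y => w y * g y ^ 2) := by
  set a := sphIntB n x₀ r fun y => w y * f y ^ 2
  set b := sphIntB n x₀ r fun y => w y * (f y * g y)
  set c := sphIntB n x₀ r fun y => w y * g y ^ 2
  have hq : ∀ t : ℝ, 0 ≤ a * (t * t) + 2 * b * t + c := fun t => by
    have h0 : sphIntB n x₀ r (fun y => 0 * w y) ≤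
        sphIntB n x₀ r fun y => (t * t) * (w y * f y ^ 2) + (2 * t) * (w y * (f y * g y)) +
          w y * g y ^ 2 := by
      refine sphIntB_mono hr (by fun_prop) (by fun_prop) fun y hy => ?_
      have := hw y (by simpa [dist_eq_norm, hy] using hr.2)
      nlinarith [mul_nonneg this (sq_nonneg (t * f y + g y))]
    rw [sphIntB_const_mul, zero_mul, sphIntB_add hr (by fun_prop) (by fun_prop),
      sphIntB_add hr (by fun_prop) (by fun_prop), sphIntB_const_mul, sphIntB_const_mul] at h0
    linarith
  have := discrim_le_zero hq
  rw [discrim] at this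
  linarith

lemma ball_infDist_frontier_subset {n : ℕ} {O : Set (Euc n)} {x : Euc n} (hx : x ∈ O) :
    ball x (infDist x (frontier O)) ⊆ O := by
  rcases eq_or_ne O univ with rfl | hne
  · simp
  · obtain ⟨y, hy, hxy⟩ := exists_mem_frontier_infDist_compl_eq_dist hx hne
    refine (ball_subset_ball ?_).trans (ball_infDist_compl_subset (x := x))
    rw [hxy]
    exact infDist_le_dist_of_mem hy

lemma sphIntB_inner_gradient_le {n : ℕ} {O : Set (Euc n)} (hO : IsOpen O) {ϰ : ℝ} (hϰ : 0 < ϰ)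
    {σ u : Euc n → ℝ} (hσ : ContDiffOn ℝ 1 σ O) (hσbd : ∀ x ∈ O, ϰ⁻¹ ≤ σ x)
    (hgradσ : ∀ x ∈ O, ‖gradient σ x‖ ≤ ϰ) (hu : ContinuousOn u O) {x₀ : Euc n} {R : ℝ}
    (hRO : closedBall x₀ R ⊆ O) {r : ℝ} (hr : r ∈ Icc 0 R) :
    sphIntB n x₀ r (fun y => u y ^ 2 * ⟪gradient σ y, y - x₀⟫) ≤ r * ϰ ^ 2 * Hfn σ u x₀ r := by
  have cσ := hσ.continuousOn.mono hRO
  have cu := hu.mono hRO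
  have cGσ := (contDiffOn_gradient hO hσ (k := 0) (by norm_num)).continuousOn.mono hRO
  rw [Hfn, ← sphIntB_const_mul]
  refine sphIntB_mono hr (by fun_prop) (by fun_prop) fun y hy => ?_
  have hyO : y ∈ O := hRO (by simpa [dist_eq_norm, hy] using hr.2)
  have h1 : ⟪gradient σ y, y - x₀⟫ ≤ ϰ * r := by
    refine (real_inner_le_norm _ _).trans ?_
    rw [hy]
    exact mul_le_mul_of_nonneg_right (hgradσ y hyO) hr.1
  have h2 : 1 ≤ ϰ * σ y := (inv_le_iff_one_le_mul₀' hϰ).1 (hσbd y hyO)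
  calc u y ^ 2 * ⟪gradient σ y, y - x₀⟫ ≤ u y ^ 2 * (ϰ * r) * 1 := by
        rw [mul_one]; gcongr
    _ ≤ u y ^ 2 * (ϰ * r) * (ϰ * σ y) :=
        mul_le_mul_of_nonneg_left h2 (mul_nonneg (sq_nonneg _) (mul_nonneg hϰ.le hr.1))
    _ = r * ϰ ^ 2 * (σ y * u y ^ 2) := by ring

lemma neg_mul_Dfn_le_Dtilde {n : ℕ} {O : Set (Euc n)} (hO : IsOpen O) {ϰ : ℝ} (hϰ : 0 < ϰ)
    {σ u : Euc n → ℝ} (hσ : ContDiffOn ℝ 1 σ O) (hσbd : ∀ x ∈ O, ϰ⁻¹ ≤ σ x)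
    (hgradσ : ∀ x ∈ O, ‖gradient σ x‖ ≤ ϰ) (hu : ContDiffOn ℝ 1 u O) {x₀ : Euc n} {r : ℝ}
    (hrO : closedBall x₀ r ⊆ O) (hr : 0 ≤ r) :
    -(r * ϰ ^ 2) * Dfn σ u x₀ r ≤ Dtilde σ u x₀ r := by
  have cσ := hσ.continuousOn.mono hrO
  have cGu := (contDiffOn_gradient hO hu (k := 0) (by norm_num)).continuousOn.mono hrO
  have cGσ := (contDiffOn_gradient hO hσ (k := 0) (by norm_num)).continuousOn.mono hrO
  have hint : ∀ {f : Euc n → ℝ}, ContinuousOn f (closedBall x₀ r) →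
      IntegrableOn f (ball x₀ r) := fun hf =>
    (hf.integrableOn_compact (isCompact_closedBall _ _)).mono_set ball_subset_closedBall
  rw [Dfn, Dtilde, ← integral_const_mul]
  refine setIntegral_mono_on (hint (by fun_prop)) (hint (by fun_prop)) measurableSet_ball
    fun y hy => ?_
  have hyO : y ∈ O := hrO (ball_subset_closedBall hy)
  have hyr : ‖y - x₀‖ ≤ r := by rw [← dist_eq_norm]; exact (mem_ball.1 hy).le
  have h1 : -⟪gradient σ y, y - x₀⟫ ≤ ϰ * r :=
    (neg_le_abs _).trans ((abs_real_inner_le_norm _ _).trans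
      (mul_le_mul (hgradσ y hyO) hyr (norm_nonneg _) hϰ.le))
  have h2 : 1 ≤ ϰ * σ y := (inv_le_iff_one_le_mul₀' hϰ).1 (hσbd y hyO)
  have h3 : ϰ * r ≤ ϰ * r * (ϰ * σ y) := le_mul_of_one_le_right (mul_nonneg hϰ.le hr) h2
  have h4 := mul_le_mul_of_nonneg_left (h1.trans h3) (sq_nonneg ‖gradient u y‖)
  linarith

/-- Almost-monotonicity of the frequency function:
`ρ ↦ e^{2ϰ²ρ} N(x₀,ρ)` is nondecreasing on `(0,δ]`, and in particular
`N(x₀,r) ≤ e^{2ϰ²δ} N(x₀,δ)` for `0 < r < δ`. -/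
theorem stmt15 (n : ℕ) (hn : 2 ≤ n) (O : Set (Euc n)) (hO : IsOpen O)
    (hObd : Bornology.IsBounded O) (ϰ : ℝ) (hϰ : 1 < ϰ) (σ u : Euc n → ℝ)
    (hσ : ContDiffOn ℝ 1 σ O)
    (hσbd : ∀ x ∈ O, ϰ⁻¹ ≤ σ x ∧ σ x ≤ ϰ)
    (hgradσ : ∀ x ∈ O, ‖gradient σ x‖ ≤ ϰ)
    (hu : ContDiffOn ℝ 2 u O)
    (hpde : ∀ x ∈ O, vdiv (fun y => σ y • gradient u y) x = 0)
    (δ : ℝ) (hδ : 0 < δ) (x₀ : Euc n) (hx₀ : x₀ ∈ O)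
    (hx₀δ : δ < infDist x₀ (frontier O))
    (hHpos : ∀ ρ ∈ Ioc (0 : ℝ) δ, 0 < Hfn σ u x₀ ρ) :
    MonotoneOn (fun ρ => Real.exp (2 * ϰ ^ 2 * ρ) * (ρ * Dfn σ u x₀ ρ / Hfn σ u x₀ ρ))
        (Ioc (0 : ℝ) δ) ∧
    ∀ r : ℝ, 0 < r → r < δ →
      r * Dfn σ u x₀ r / Hfn σ u x₀ r
        ≤ Real.exp (2 * ϰ ^ 2 * δ) * (δ * Dfn σ u x₀ δ / Hfn σ u x₀ δ) := by
  have hn0 : n ≠ 0 := by omega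
  have hϰ0 : 0 < ϰ := one_pos.trans hϰ
  obtain ⟨R, hδR, hR⟩ := exists_between hx₀δ
  have hRO : closedBall x₀ R ⊆ O :=
    (closedBall_subset_ball hR).trans (ball_infDist_frontier_subset hx₀)
  have hσ0 : ∀ x ∈ O, 0 ≤ σ x := fun x hx => (inv_pos.2 hϰ0).le.trans (hσbd x hx).1
  have hu1 : ContDiffOn ℝ 1 u O := hu.of_le (by norm_num)
  have cσ := hσ.continuousOn.mono hRO
  have cu := hu.continuousOn.mono hRO
  have cG := (contDiffOn_gradient hO hu1 (k := 0) (by norm_num)).continuousOn.mono hRO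
  have hD0 : ∀ r ∈ Ioc 0 δ, 0 ≤ Dfn σ u x₀ r := fun r hr =>
    setIntegral_nonneg measurableSet_ball fun x hx => mul_nonneg
      (hσ0 x (hRO (closedBall_subset_closedBall (hr.2.trans hδR.le)
        (ball_subset_closedBall hx)))) (sq_nonneg _)
  have hderiv : ∀ r ∈ Ioc 0 δ, ∃ d, 0 ≤ d ∧ HasDerivAt (fun ρ =>
      Real.exp (2 * ϰ ^ 2 * ρ) * (ρ * Dfn σ u x₀ ρ / Hfn σ u x₀ ρ)) d r := by
    intro r hr
    have hrR : r ∈ Ioo 0 R := ⟨hr.1, hr.2.trans_lt hδR⟩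
    have hrI : r ∈ Icc 0 R := Ioo_subset_Icc_self hrR
    have hH := hHpos r hr
    have hD := hD0 r hr
    have hDd : HasDerivAt (Dfn σ u x₀) _ r :=
      hasDerivAt_setIntegral_ball (f := fun x => σ x * ‖gradient u x‖ ^ 2) hn0 (by fun_prop) hrR
    have hHd := hasDerivAt_Hfn hn0 hO hσ hu1 hRO hrR
    have hM := mul_Dfn_eq_sphIntB hn0 hO hσ hu hpde hRO hrR
    have hrel := rellich_identity hn0 hO hσ hu hpde hRO hrR
    have hcs := sphIntB_cauchy_schwarz (n := n) hrI cσ cu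
      (g := fun y => ⟪gradient u y, y - x₀⟫) (by fun_prop) fun y hy => hσ0 y (hRO hy)
    have hQ := sphIntB_inner_gradient_le hO hϰ0 hσ (fun x hx => (hσbd x hx).1) hgradσ
      hu.continuousOn hRO hrI
    have hT := neg_mul_Dfn_le_Dtilde hO hϰ0 hσ (fun x hx => (hσbd x hx).1) hgradσ hu1
      ((closedBall_subset_closedBall hrI.2).trans hRO) hr.1.le
    have hexp : HasDerivAt (fun ρ => Real.exp (2 * ϰ ^ 2 * ρ)) _ r :=
      ((hasDerivAt_id r).const_mul (2 * ϰ ^ 2)).exp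
    refine ⟨_, ?_, hexp.fun_mul (((hasDerivAt_id r).fun_mul hDd).fun_div hHd hH.ne')⟩
    rw [← hM] at hcs hHd ⊢
    rw [show sphIntB n x₀ r (fun y => σ y * u y ^ 2) = Hfn σ u x₀ r from rfl] at hcs
    generalize sphIntB n x₀ r (fun y => σ y * ‖gradient u y‖ ^ 2) = E at *
    generalize sphIntB n x₀ r (fun y => σ y * ⟪gradient u y, y - x₀⟫ ^ 2) = P at *
    generalize sphIntB n x₀ r (fun y => u y ^ 2 * ⟪gradient σ y, y - x₀⟫) = Q at *
    generalize Dtilde σ u x₀ r = T at *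
    generalize Hfn σ u x₀ r = H at *
    generalize Dfn σ u x₀ r = D at *
    have hr0 := hr.1.ne'
    have hT' := mul_le_mul_of_nonneg_right hT hH.le
    have hQ' := mul_le_mul_of_nonneg_left hQ hD
    have hnum : 0 ≤ r * (2 * ϰ ^ 2 * r * D * H + T * H - D * Q) + 2 * (P * H - (r * D) ^ 2) :=
      add_nonneg (mul_nonneg hr.1.le (by linarith)) (by linarith)
    have hE : E = (r * ((n - 2) * D + T) + 2 * P) / r ^ 2 := by
      field_simp
      linarith
    have hpos := div_nonneg (mul_nonneg (Real.exp_pos (2 * ϰ ^ 2 * r)).le hnum)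
      (mul_pos hr.1 (pow_pos hH 2)).le
    refine hpos.trans_eq ?_
    rw [hE]
    simp only [id]
    field_simp
    ring
  have hmono : MonotoneOn (fun ρ =>
      Real.exp (2 * ϰ ^ 2 * ρ) * (ρ * Dfn σ u x₀ ρ / Hfn σ u x₀ ρ)) (Ioc 0 δ) := by
    choose! d hd0 hd using hderiv
    exact monotoneOn_of_hasDerivWithinAt_nonneg (convex_Ioc 0 δ)
      (fun r hr => (hd r hr).continuousAt.continuousWithinAt)
      (fun r hr => (hd r (interior_subset hr)).hasDerivWithinAt)
      fun r hr => hd0 r (interior_subset hr)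
  refine ⟨hmono, fun r hr0 hrδ => le_trans ?_ (hmono ⟨hr0, hrδ.le⟩ ⟨hδ, le_rfl⟩ hrδ.le)⟩
  exact le_mul_of_one_le_left
    (div_nonneg (mul_nonneg hr0.le (hD0 r ⟨hr0, hrδ.le⟩)) (hHpos r ⟨hr0, hrδ.le⟩).le)
    (Real.one_le_exp (by positivity))

end
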